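/- arXiv:2307.10122 — 3 statements merged into one kernel-verified Lean document; each statement's English description precedes it below -/
import Mathlib

section
/- Weighted Kim–Shapira theorem, liminf form: Let α be a real m×n matrix that is (τ,η)-non-singular. Then for Lebesgue-almost every γ ∈ ℝ^n, for every ε > 0 and every N > 0 there exists a ∈ ℤ^m with |a|_η > N such that |a|_η · min_{b ∈ ℤ^n} |aα − b − γ|_τ < ε; that is, liminf_{|a|_η → ∞} |a|_η · min_{b ∈ ℤ^n} |aα − b − γ|_τ = 0. -/
/-- The weighted quasi-norm `|x|_τ = max_i |x_i|^(1/τ_i)` on `ℝ^n`. -/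
noncomputable def quasiNorm {n : ℕ} (τ : Fin n → ℝ) (x : Fin n → ℝ) : ℝ :=
  ⨆ i, |x i| ^ (1 / τ i)

/-- `α` is `(τ,η)`-singular. -/
def IsSingular {m n : ℕ} (τ : Fin n → ℝ) (η : Fin m → ℝ)
    (α : Matrix (Fin m) (Fin n) ℝ) : Prop :=
  ∀ ε > (0 : ℝ), ∃ H₀ : ℝ, ∀ H > H₀, ∃ (a : Fin m → ℤ) (b : Fin n → ℤ), a ≠ 0 ∧
    quasiNorm τ (fun i => (∑ j, (a j : ℝ) * α j i) - (b i : ℝ)) < ε * H⁻¹ ∧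
    quasiNorm η (fun j => (a j : ℝ)) ≤ H

open MeasureTheory Matrix in
/-- A unimodular lattice without short nonzero vectors has bounded covering radius. -/
theorem exists_int_norm_mulVec_sub_lt {ι : Type*} [Fintype ι] [DecidableEq ι] {δ : ℝ} (hδ : 0 < δ)
    {K : ℕ} (hK : 1 < ((K : ℝ) + 1) * δ ^ Fintype.card ι) (M : Matrix ι ι ℝ) (hM : |M.det| = 1)
    (hsep : ∀ z : ι → ℤ, z ≠ 0 → δ ≤ ‖M *ᵥ (fun i => (z i : ℝ))‖) (y : ι → ℝ) :
    ∃ z : ι → ℤ, ‖M *ᵥ (fun i => (z i : ℝ)) - y‖ < K * δ + 1 := by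
  by_contra! hy
  set Λ : Set (ι → ℝ) := Set.range fun z : ι → ℤ => M *ᵥ (fun i => (z i : ℝ)) with hΛ
  have hzero : (0 : ι → ℝ) ∈ Λ := ⟨0, by simp [← Pi.zero_def]⟩
  have hshift (z : ι → ℤ) (x : ι → ℝ) :
      Metric.infDist (M *ᵥ (fun i => (z i : ℝ)) + x) Λ = Metric.infDist x Λ := by
    have himg : (fun v => M *ᵥ (fun i => (z i : ℝ)) + v) '' Λ = Λ := by
      ext v
      constructor
      · rintro ⟨_, ⟨w, rfl⟩, rfl⟩
        refine ⟨z + w, ?_⟩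
        simp only [← Matrix.mulVec_add]
        congr 1
        ext i
        simp
      · rintro ⟨w, rfl⟩
        refine ⟨_, ⟨w - z, rfl⟩, ?_⟩
        simp only [← Matrix.mulVec_add]
        congr 1
        ext i
        simp
    conv_lhs => rw [← himg]
    exact Metric.infDist_image (isometry_add_left _)
  have hfar : K * δ ≤ Metric.infDist y Λ := by
    refine (Metric.le_infDist ⟨0, hzero⟩).2 ?_
    rintro _ ⟨z, rfl⟩
    rw [dist_comm, dist_eq_norm]
    linarith [hy z]
  have hpath (j : Fin (K + 1)) : ∃ x : ι → ℝ, Metric.infDist x Λ = j * δ := by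
    have hcont : ContinuousOn (fun t : ℝ => Metric.infDist (t • y) Λ) (Set.Icc 0 1) := by
      have := Metric.continuous_infDist_pt Λ
      fun_prop
    have hj : (j : ℝ) ≤ K := by exact_mod_cast Nat.lt_succ_iff.1 j.2
    obtain ⟨t, -, ht⟩ := intermediate_value_Icc zero_le_one hcont
      (show (j : ℝ) * δ ∈ _ from ⟨by simp [Metric.infDist_zero_of_mem hzero]; positivity, by
        simpa using (mul_le_mul_of_nonneg_right hj hδ.le).trans hfar⟩)
    exact ⟨t • y, ht⟩
  choose x hx using hpath
  have hclose (i j : Fin (K + 1)) (z : ι → ℤ)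
      (h : dist (x i) (M *ᵥ (fun i => (z i : ℝ)) + x j) < δ) : i = j := by
    have h1 := Metric.infDist_le_infDist_add_dist (s := Λ) (x := x i)
      (y := M *ᵥ (fun i => (z i : ℝ)) + x j)
    have h2 := Metric.infDist_le_infDist_add_dist (s := Λ) (y := x i)
      (x := M *ᵥ (fun i => (z i : ℝ)) + x j)
    rw [dist_comm] at h2
    rw [hshift, hx, hx] at h1 h2
    have h3 : ((i : ℕ) : ℝ) < (j : ℕ) + 1 := by
      by_contra! hc
      nlinarith
    have h4 : ((j : ℕ) : ℝ) < (i : ℕ) + 1 := by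
      by_contra! hc
      nlinarith
    have h5 : (i : ℕ) < j + 1 := by exact_mod_cast h3
    have h6 : (j : ℕ) < i + 1 := by exact_mod_cast h4
    exact Fin.ext (by omega)
  set S : Set (ι → ℝ) := ⋃ j, Metric.ball (x j) (δ / 2) with hS
  have hSm : MeasurableSet S := MeasurableSet.iUnion fun j => measurableSet_ball
  have hvol : 1 < volume S := by
    rw [hS, measure_iUnion _ fun j => measurableSet_ball]
    · simp only [Real.volume_pi_ball _ (half_pos hδ), mul_div_cancel₀ δ (two_ne_zero' ℝ),
        tsum_fintype, Finset.sum_const, Finset.card_univ, Fintype.card_fin, nsmul_eq_mul]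
      rw [← ENNReal.ofReal_natCast, ← ENNReal.ofReal_mul (by positivity), ENNReal.one_lt_ofReal]
      exact_mod_cast hK
    · intro i j hij
      refine Set.disjoint_left.2 fun v hi hj => hij (hclose i j 0 ?_)
      have h0 : M *ᵥ (fun i => (((0 : ι → ℤ) i : ℤ) : ℝ)) = 0 := by
        simp [← Pi.zero_def]
      rw [h0, zero_add]
      rw [Metric.mem_ball] at hi hj
      linarith [dist_triangle_left (x i) (x j) v]
  have hdet : LinearMap.det (Matrix.toLin' M) ≠ 0 := by
    rw [LinearMap.det_toLin']
    intro h
    simp [h] at hM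
  have hpre : volume (Matrix.toLin' M ⁻¹' S) = volume S := by
    rw [Measure.addHaar_preimage_linearMap _ hdet, LinearMap.det_toLin', abs_inv, hM]
    simp
  have hmeas : MeasurableSet (Matrix.toLin' M ⁻¹' S) :=
    (LinearMap.continuous_of_finiteDimensional (Matrix.toLin' M)).measurable hSm
  have : Countable (Submodule.span ℤ (Set.range (Pi.basisFun ℝ ι))).toAddSubgroup :=
    inferInstanceAs (Countable (Submodule.span ℤ (Set.range (Pi.basisFun ℝ ι))))
  obtain ⟨p, q, hpq, hnd⟩ := exists_pair_mem_lattice_not_disjoint_vadd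
    (ZSpan.isAddFundamentalDomain' (Pi.basisFun ℝ ι) volume) hmeas.nullMeasurableSet (by
      rw [hpre, ZSpan.fundamentalDomain_pi_basisFun, Real.volume_pi_Ico]
      simpa using hvol)
  obtain ⟨v, ⟨u, hu, huv⟩, ⟨w, hw, hwv⟩⟩ := Set.not_disjoint_iff.1 hnd
  obtain ⟨i, hi⟩ := Set.mem_iUnion.1 hu
  obtain ⟨j, hj⟩ := Set.mem_iUnion.1 hw
  have hcast : ∃ z : ι → ℤ, (fun i => (z i : ℝ)) = (q - p : ι → ℝ) := by
    have hz := ((Pi.basisFun ℝ ι).mem_span_iff_repr_mem ℤ (q - p : ι → ℝ)).1 (q - p).2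
    choose z hz using hz
    exact ⟨z, funext fun i => by simpa using hz i⟩
  obtain ⟨z, hz⟩ := hcast
  have hz0 : z ≠ 0 := by
    rintro rfl
    refine hpq (Subtype.ext (sub_eq_zero.1 ?_).symm)
    rw [← hz]
    ext i
    simp
  have huw : M *ᵥ u = M *ᵥ (fun i => (z i : ℝ)) + M *ᵥ w := by
    have hsum : (p : ι → ℝ) + u = q + w := huv.trans hwv.symm
    rw [← Matrix.mulVec_add, hz]
    congr 1
    linear_combination hsum
  rw [Metric.mem_ball, Matrix.toLin'_apply] at hi hj
  have hij : i = j := by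
    refine hclose i j z ((dist_triangle_left _ _ (M *ᵥ u)).trans_lt ?_)
    nth_rewrite 2 [huw]
    rw [dist_add_left]
    linarith
  subst hij
  have hlt := (dist_triangle_right (M *ᵥ u) (M *ᵥ w) (x i)).trans_lt (add_lt_add hi hj)
  rw [dist_eq_norm, huw, add_sub_cancel_right] at hlt
  linarith [hsep z hz0]

open MeasureTheory Filter Topology in
/-- A closed set with holes of fixed relative size at arbitrarily small (anisotropic) scales
around every point is Lebesgue null. -/
theorem volume_eq_zero_of_porous {n : ℕ} {F : Set (Fin n → ℝ)} (hF : IsClosed F) {c : ℝ}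
    (hc : 0 < c) (hc1 : c ≤ 1)
    (h : ∀ r > 0, ∃ w : Fin n → ℝ, (∀ i, 0 < w i ∧ w i < r) ∧ ∀ x : Fin n → ℝ, ∃ p : Fin n → ℝ,
      (∀ i, |p i - x i| ≤ w i) ∧ ∀ y, (∀ i, |y i - p i| < c * w i) → y ∉ F) :
    volume F = 0 := by
  set q : ENNReal := ENNReal.ofReal ((c / 2) ^ n) with hq
  have hq0 : q ≠ 0 := by
    simp only [hq, ne_eq, ENNReal.ofReal_eq_zero, not_le]
    positivity
  have hcompact (K : Set (Fin n → ℝ)) (hK : IsCompact K) (hKF : K ⊆ F) : volume K = 0 := by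
    have hthick (r : ℝ) (hr : 0 < r) : volume K ≤ (1 - q) * volume (Metric.cthickening r K) := by
      obtain ⟨w, hw, hp⟩ := h (r / 4) (by positivity)
      set T := Metric.cthickening r K with hT
      have hTm : MeasurableSet T := Metric.isClosed_cthickening.measurableSet
      set Q : (Fin n → ℤ) → Set (Fin n → ℝ) := fun k =>
        Set.univ.pi fun i => Set.Ico (4 * w i * k i) (4 * w i * (k i + 1)) with hQ
      have hQm (k) : MeasurableSet (Q k) :=
        MeasurableSet.univ_pi fun i => measurableSet_Ico
      have hmem (k) (y : Fin n → ℝ) : y ∈ Q k ↔ ∀ i, ⌊y i / (4 * w i)⌋ = k i := by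
        simp only [hQ, Set.mem_pi, Set.mem_univ, true_imp_iff, Set.mem_Ico, Int.floor_eq_iff]
        refine forall_congr' fun i => ?_
        have := (hw i).1
        rw [le_div_iff₀ (by positivity), div_lt_iff₀ (by positivity), mul_comm (4 * w i),
          mul_comm (4 * w i)]
      have hcover : ⋃ k, Q k = Set.univ :=
        Set.eq_univ_of_forall fun y => Set.mem_iUnion.2 ⟨_, (hmem _ y).2 fun i => rfl⟩
      have hdisj : Pairwise (Function.onFun Disjoint Q) := fun k l hkl =>
        Set.disjoint_left.2 fun y hk hl => hkl <| funext fun i =>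
          ((hmem k y).1 hk i).symm.trans ((hmem l y).1 hl i)
      have hvolQ (k) : volume (Q k) = ENNReal.ofReal (∏ i, 4 * w i) := by
        rw [hQ, Real.volume_pi_Ico, ENNReal.ofReal_prod_of_nonneg]
        · exact Finset.prod_congr rfl fun i _ => by ring_nf
        · exact fun i _ => by linarith [(hw i).1]
      have hsmall (k) : volume (K ∩ Q k) ≤ (1 - q) * volume (Q k) := by
        obtain ⟨p, hpx, hpF⟩ := hp fun i => 4 * w i * k i + 2 * w i
        set B : Set (Fin n → ℝ) := Set.univ.pi fun i => Set.Ioo (p i - c * w i) (p i + c * w i)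
          with hB
        have hBQ : B ⊆ Q k := by
          intro y hy i hi
          have h1 := hy i hi
          have h2 := abs_le.1 (hpx i)
          have h3 := (hw i).1
          have h4 : c * w i ≤ w i := by nlinarith
          simp only [Set.mem_Ioo] at h1
          constructor <;> linarith [h1.1, h1.2, h2.1, h2.2]
        have hBm : MeasurableSet B := MeasurableSet.univ_pi fun i => measurableSet_Ioo
        have hvolB : volume B = q * volume (Q k) := by
          rw [hvolQ, hB, Real.volume_pi_Ioo, hq, ← ENNReal.ofReal_mul (by positivity),
            ← ENNReal.ofReal_prod_of_nonneg]
          · congr 1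
            have : (c / 2) ^ n = ∏ _i : Fin n, c / 2 := by
              rw [Finset.prod_const, Finset.card_univ, Fintype.card_fin]
            rw [this, ← Finset.prod_mul_distrib]
            exact Finset.prod_congr rfl fun i _ => by ring
          · exact fun i _ => by nlinarith [(hw i).1]
        have hfin : volume (Q k) ≠ ⊤ := by simp [hvolQ]
        calc volume (K ∩ Q k) ≤ volume (Q k \ B) := by
              refine measure_mono fun y hy => ⟨hy.2, fun hyB => hpF y (fun i => ?_) (hKF hy.1)⟩
              have := hyB i trivial
              rw [abs_lt]
              constructor <;> linarith [this.1, this.2]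
          _ = volume (Q k) - volume B :=
              measure_sdiff hBQ hBm.nullMeasurableSet (measure_ne_top_of_subset hBQ hfin)
          _ = (1 - q) * volume (Q k) := by
              rw [hvolB, ENNReal.sub_mul fun _ _ => hfin, one_mul]
      have hlocal (k) : volume (K ∩ Q k) ≤ (1 - q) * volume (T ∩ Q k) := by
        rcases (K ∩ Q k).eq_empty_or_nonempty with hE | ⟨y, hyK, hyQ⟩
        · simp [hE]
        · have hQT : Q k ⊆ T := by
            intro z hz
            refine Metric.mem_cthickening_of_dist_le z y r K hyK ?_
            refine (dist_pi_le_iff hr.le).2 fun i => ?_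
            have h1 := hyQ i trivial
            have h2 := hz i trivial
            have h3 := (hw i).2
            simp only [Set.mem_Ico] at h1 h2
            rw [Real.dist_eq, abs_le]
            constructor <;> linarith [h1.1, h1.2, h2.1, h2.2]
          rw [Set.inter_eq_right.2 hQT]
          exact hsmall k
      calc volume K = volume (⋃ k, K ∩ Q k) := by rw [← Set.inter_iUnion, hcover, Set.inter_univ]
        _ ≤ ∑' k, volume (K ∩ Q k) := measure_iUnion_le _
        _ ≤ ∑' k, (1 - q) * volume (T ∩ Q k) := ENNReal.tsum_le_tsum hlocal
        _ = (1 - q) * volume (⋃ k, T ∩ Q k) := by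
            rw [ENNReal.tsum_mul_left, measure_iUnion (hdisj.mono fun k l hkl =>
              hkl.mono Set.inter_subset_right Set.inter_subset_right) fun k => hTm.inter (hQm k)]
        _ = (1 - q) * volume T := by rw [← Set.inter_iUnion, hcover, Set.inter_univ]
    have hlim : volume K ≤ (1 - q) * volume K := by
      have ht : Tendsto (fun r => (1 - q) * volume (Metric.cthickening r K)) (𝓝[>] 0)
          (𝓝 ((1 - q) * volume K)) :=
        ENNReal.Tendsto.const_mul
          ((tendsto_measure_cthickening_of_isCompact hK).mono_left nhdsWithin_le_nhds)
          (Or.inr (by simp))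
      exact ge_of_tendsto ht (eventually_mem_nhdsWithin.mono hthick)
    by_contra h0
    have hfin : volume K ≠ ⊤ := hK.measure_lt_top.ne
    have hlt : (1 - q) * volume K < 1 * volume K :=
      ENNReal.mul_lt_mul_left h0 hfin (ENNReal.sub_lt_self ENNReal.one_ne_top one_ne_zero hq0)
    rw [one_mul] at hlt
    exact absurd hlim (not_le.2 hlt)
  have hball : F = ⋃ N : ℕ, F ∩ Metric.closedBall 0 N := by
    rw [← Set.inter_iUnion, Metric.iUnion_closedBall_nat, Set.inter_univ]
  rw [hball, measure_iUnion_null_iff]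
  exact fun N => hcompact _ ((isCompact_closedBall _ _).inter_left hF) Set.inter_subset_left

theorem quasiNorm_le_iff {n : ℕ} [Nonempty (Fin n)] {τ : Fin n → ℝ} (hτ : ∀ i, 0 < τ i)
    {x : Fin n → ℝ} {r : ℝ} (hr : 0 ≤ r) : quasiNorm τ x ≤ r ↔ ∀ i, |x i| ≤ r ^ τ i := by
  rw [quasiNorm, ciSup_le_iff (Set.finite_range _).bddAbove]
  refine forall_congr' fun i => ?_
  rw [one_div, Real.rpow_inv_le_iff_of_pos (abs_nonneg _) hr (hτ i)]

theorem quasiNorm_lt_iff {n : ℕ} [Nonempty (Fin n)] {τ : Fin n → ℝ} (hτ : ∀ i, 0 < τ i)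
    {x : Fin n → ℝ} {r : ℝ} (hr : 0 ≤ r) : quasiNorm τ x < r ↔ ∀ i, |x i| < r ^ τ i := by
  simp_rw [← Real.rpow_inv_lt_iff_of_pos (abs_nonneg _) hr (hτ _), ← one_div]
  refine ⟨fun h i => (le_ciSup (Set.finite_range fun i => |x i| ^ (1 / τ i)).bddAbove i).trans_lt h,
    fun h => ?_⟩
  obtain ⟨i, hi⟩ := exists_eq_ciSup_of_finite (f := fun i => |x i| ^ (1 / τ i))
  exact hi.symm.trans_lt (h i)

theorem quasiNorm_nonneg {n : ℕ} (τ : Fin n → ℝ) (x : Fin n → ℝ) : 0 ≤ quasiNorm τ x :=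
  Real.iSup_nonneg fun _ => by positivity

/-- The matrix of `(b, a) ↦ (H^τ (aα - b), H^(-η) a)`. -/
noncomputable def dynamicalMatrix {m n : ℕ} (τ : Fin n → ℝ) (η : Fin m → ℝ)
    (α : Matrix (Fin m) (Fin n) ℝ) (H : ℝ) : Matrix (Fin n ⊕ Fin m) (Fin n ⊕ Fin m) ℝ :=
  Matrix.fromBlocks (Matrix.diagonal fun i => -H ^ τ i) (Matrix.of fun i j => H ^ τ i * α j i) 0
    (Matrix.diagonal fun j => H ^ (-η j))

section

variable {m n : ℕ} {τ : Fin n → ℝ} {η : Fin m → ℝ} {α : Matrix (Fin m) (Fin n) ℝ} {H : ℝ}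

open Matrix

theorem abs_det_dynamicalMatrix (hw : ∑ i, τ i = ∑ j, η j) (hH : 0 < H) :
    |(dynamicalMatrix τ η α H).det| = 1 := by
  rw [dynamicalMatrix, Matrix.det_fromBlocks_zero₂₁, Matrix.det_diagonal, Matrix.det_diagonal,
    abs_mul, Finset.abs_prod, Finset.abs_prod]
  simp_rw [abs_neg, abs_of_pos (Real.rpow_pos_of_pos hH _)]
  rw [← Real.rpow_sum_of_pos hH, ← Real.rpow_sum_of_pos hH, ← Real.rpow_add hH,
    Finset.sum_neg_distrib, hw, add_neg_cancel, Real.rpow_zero]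

theorem dynamicalMatrix_mulVec_inl (z : Fin n ⊕ Fin m → ℝ) (i : Fin n) :
    (dynamicalMatrix τ η α H *ᵥ z) (Sum.inl i) =
      H ^ τ i * (∑ j, z (Sum.inr j) * α j i - z (Sum.inl i)) := by
  rw [dynamicalMatrix, Matrix.fromBlocks_mulVec, Sum.elim_inl, Pi.add_apply,
    Matrix.mulVec_diagonal, Matrix.mulVec, dotProduct, mul_sub, Finset.mul_sum]
  simp only [Matrix.of_apply, Function.comp_apply]
  rw [Finset.sum_congr rfl fun j _ =>
    show H ^ τ i * α j i * z (Sum.inr j) = H ^ τ i * (z (Sum.inr j) * α j i) by ring]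
  ring

theorem dynamicalMatrix_mulVec_inr (z : Fin n ⊕ Fin m → ℝ) (j : Fin m) :
    (dynamicalMatrix τ η α H *ᵥ z) (Sum.inr j) = H ^ (-η j) * z (Sum.inr j) := by
  rw [dynamicalMatrix, Matrix.fromBlocks_mulVec, Sum.elim_inr, Pi.add_apply,
    Matrix.mulVec_diagonal, Matrix.zero_mulVec, Pi.zero_apply, zero_add, Function.comp_apply]

theorem exists_separation_of_not_isSingular (hm : 0 < m) (hn : 0 < n) (hτ : ∀ i, 0 < τ i)
    (hη : ∀ j, 0 < η j) (hα : ¬ IsSingular τ η α) :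
    ∃ δ > 0, ∀ H₀ : ℝ, ∃ H > H₀, 1 ≤ H ∧ ∀ z : Fin n ⊕ Fin m → ℤ, z ≠ 0 →
      δ ≤ ‖dynamicalMatrix τ η α H *ᵥ fun i => (z i : ℝ)‖ := by
  have : Nonempty (Fin n) := ⟨⟨0, hn⟩⟩
  have : Nonempty (Fin m) := ⟨⟨0, hm⟩⟩
  simp only [IsSingular] at hα
  push Not at hα
  obtain ⟨ε, hε, hα⟩ := hα
  have hε' : 0 < min ε 1 := by positivity
  have hδ1 : min ε 1 ^ (∑ i, τ i) ≤ 1 :=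
    Real.rpow_le_one hε'.le (min_le_right _ _) (Finset.sum_nonneg fun i _ => (hτ i).le)
  have hδτ (i) : min ε 1 ^ (∑ i, τ i) ≤ min ε 1 ^ τ i :=
    Real.rpow_le_rpow_of_exponent_ge hε' (min_le_right _ _)
      (Finset.single_le_sum (fun i _ => (hτ i).le) (Finset.mem_univ i))
  refine ⟨min ε 1 ^ (∑ i, τ i), by positivity, fun H₀ => ?_⟩
  obtain ⟨H, hH, hsep⟩ := hα (max H₀ 1)
  have hH1 : 1 ≤ H := (le_max_right _ _).trans hH.le
  have hH0 : 0 < H := by linarith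
  refine ⟨H, (le_max_left _ _).trans_lt hH, hH1, fun z hz => ?_⟩
  by_contra! hlt
  have hcoord (k) := (norm_le_pi_norm (dynamicalMatrix τ η α H *ᵥ fun i => (z i : ℝ)) k).trans_lt hlt
  have hl (i : Fin n) : H ^ τ i * |∑ j, (z (Sum.inr j) : ℝ) * α j i - z (Sum.inl i)| <
      min ε 1 ^ (∑ i, τ i) := by
    have := hcoord (Sum.inl i)
    rwa [dynamicalMatrix_mulVec_inl, Real.norm_eq_abs, abs_mul,
      abs_of_pos (Real.rpow_pos_of_pos hH0 _)] at this
  have hr (j : Fin m) : |(z (Sum.inr j) : ℝ)| ≤ H ^ η j := by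
    have := (hcoord (Sum.inr j)).le.trans hδ1
    rwa [dynamicalMatrix_mulVec_inr, Real.norm_eq_abs, abs_mul,
      abs_of_pos (Real.rpow_pos_of_pos hH0 _), Real.rpow_neg hH0.le, inv_mul_le_iff₀ (by positivity),
      mul_one] at this
  by_cases ha : (fun j => z (Sum.inr j)) = 0
  · refine hz (funext fun k => ?_)
    rcases k with i | j
    · by_contra hb
      have h1 : (1 : ℝ) ≤ |(z (Sum.inl i) : ℝ)| := by
        exact_mod_cast Int.one_le_abs hb
      have h2 : 1 ≤ H ^ τ i := Real.one_le_rpow hH1 (hτ i).le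
      have h3 := (hl i).trans_le hδ1
      have h4 (j) : z (Sum.inr j) = 0 := congrFun ha j
      simp only [h4, Int.cast_zero, zero_mul, Finset.sum_const_zero, zero_sub, abs_neg] at h3
      nlinarith
    · exact congrFun ha j
  · refine absurd (hsep (fun j => z (Sum.inr j)) (fun i => z (Sum.inl i)) ha ?_) (not_lt.2 ?_)
    · rw [quasiNorm_lt_iff hτ (by positivity)]
      intro i
      have h1 := (hl i).trans_le ((hδτ i).trans
        (Real.rpow_le_rpow hε'.le (min_le_left _ _) (hτ i).le))
      rwa [← div_eq_mul_inv, Real.div_rpow hε.le hH0.le, lt_div_iff₀ (by positivity), mul_comm]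
    · rw [quasiNorm_le_iff hη hH0.le]
      exact hr

theorem exists_covering_of_not_isSingular (hm : 0 < m) (hn : 0 < n) (hτ : ∀ i, 0 < τ i)
    (hη : ∀ j, 0 < η j) (hw : ∑ i, τ i = ∑ j, η j) (hα : ¬ IsSingular τ η α) :
    ∃ R ≥ 1, ∀ H₀ : ℝ, ∃ H > H₀, 1 ≤ H ∧ ∀ γ : Fin n → ℝ, ∃ (a : Fin m → ℤ) (b : Fin n → ℤ),
      (∀ i, H ^ τ i * |∑ j, (a j : ℝ) * α j i - b i - γ i| ≤ R) ∧
      ∀ j, H ^ η j ≤ a j ∧ a j ≤ 3 * R * H ^ η j := by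
  obtain ⟨δ, hδ, hsep⟩ := exists_separation_of_not_isSingular hm hn hτ hη hα
  obtain ⟨K, hK⟩ := exists_nat_gt (1 / δ ^ Fintype.card (Fin n ⊕ Fin m))
  rw [div_lt_iff₀ (by positivity)] at hK
  set R := K * δ + 1 with hR
  have hR1 : 1 ≤ R := by
    have : 0 ≤ K * δ := by positivity
    linarith
  refine ⟨R, hR1, fun H₀ => ?_⟩
  obtain ⟨H, hH, hH1, hsep⟩ := hsep H₀
  have hH0 : 0 < H := by linarith
  refine ⟨H, hH, hH1, fun γ => ?_⟩
  obtain ⟨z, hz⟩ := exists_int_norm_mulVec_sub_lt hδ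
    (hK.trans_le (mul_le_mul_of_nonneg_right (by linarith) (by positivity))) _
    (abs_det_dynamicalMatrix hw hH0) hsep (Sum.elim (fun i => H ^ τ i * γ i) fun _ => 2 * R)
  have hcoord (k) := (norm_le_pi_norm _ k).trans hz.le
  refine ⟨fun j => z (Sum.inr j), fun i => z (Sum.inl i), fun i => ?_, fun j => ?_⟩
  · have := hcoord (Sum.inl i)
    rwa [Pi.sub_apply, dynamicalMatrix_mulVec_inl, Sum.elim_inl, ← mul_sub, Real.norm_eq_abs,
      abs_mul, abs_of_pos (Real.rpow_pos_of_pos hH0 _)] at this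
  · have := hcoord (Sum.inr j)
    rw [Pi.sub_apply, dynamicalMatrix_mulVec_inr, Sum.elim_inr, Real.norm_eq_abs, abs_le,
      Real.rpow_neg hH0.le, inv_mul_eq_div] at this
    have hpos : 0 < H ^ η j := by positivity
    have h1 : 1 ≤ (z (Sum.inr j) : ℝ) / H ^ η j := by linarith [this.1]
    have h2 : (z (Sum.inr j) : ℝ) / H ^ η j ≤ 3 * R := by linarith [this.2]
    exact ⟨(one_le_div hpos).1 h1, (div_le_iff₀ hpos).1 h2⟩

open MeasureTheory Filter in
theorem volume_setOf_not_approximable_eq_zero (hm : 0 < m) (hn : 0 < n) (hτ : ∀ i, 0 < τ i)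
    (hη : ∀ j, 0 < η j) (hw : ∑ i, τ i = ∑ j, η j) (hα : ¬ IsSingular τ η α) {ε N : ℝ}
    (hε : 0 < ε) (hN : 0 < N) :
    volume {γ : Fin n → ℝ | ∀ (a : Fin m → ℤ) (b : Fin n → ℤ),
      N < quasiNorm η (fun j => (a j : ℝ)) →
        ε / quasiNorm η (fun j => (a j : ℝ)) ≤
          quasiNorm τ (fun i => (∑ j, (a j : ℝ) * α j i) - (b i : ℝ) - γ i)} = 0 := by
  have : Nonempty (Fin n) := ⟨⟨0, hn⟩⟩
  have : Nonempty (Fin m) := ⟨⟨0, hm⟩⟩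
  obtain ⟨R, hR, hcov⟩ := exists_covering_of_not_isSingular hm hn hτ hη hw hα
  set C : ℝ := ∑ j, (3 * R) ^ (1 / η j) with hC
  have hCj (j) : (3 * R) ^ (1 / η j) ≤ C :=
    Finset.single_le_sum (f := fun j => (3 * R) ^ (1 / η j)) (fun j _ => by positivity)
      (Finset.mem_univ j)
  have hC1 : 1 ≤ C := (Real.one_le_rpow (by linarith) (one_div_pos.2 (hη ⟨0, hm⟩)).le).trans
    (hCj ⟨0, hm⟩)
  set κ := min ε 1 / C with hκ
  have hκ0 : 0 < κ := by positivity
  have hκ1 : κ ≤ 1 := (div_le_one (by positivity)).2 ((min_le_right _ _).trans hC1)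
  have hκε : κ ≤ ε / C := div_le_div_of_nonneg_right (min_le_left _ _) (by positivity)
  refine volume_eq_zero_of_porous (c := κ ^ (∑ i, τ i) / R) ?_ (by positivity) ?_ fun r hr => ?_
  · have hcl : ∀ (a : Fin m → ℤ) (b : Fin n → ℤ), IsClosed {γ : Fin n → ℝ |
        N < quasiNorm η (fun j => (a j : ℝ)) → ε / quasiNorm η (fun j => (a j : ℝ)) ≤
          quasiNorm τ (fun i => (∑ j, (a j : ℝ) * α j i) - (b i : ℝ) - γ i)} := by
      intro a b
      by_cases hNa : N < quasiNorm η (fun j => (a j : ℝ))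
      · rw [← isOpen_compl_iff]
        simp only [hNa, true_imp_iff, Set.compl_ofPred, not_le]
        simp_rw [quasiNorm_lt_iff hτ (div_nonneg hε.le (quasiNorm_nonneg _ _)), Set.ofPred_forall]
        exact isOpen_iInter_of_finite fun i => isOpen_lt (by fun_prop) continuous_const
      · simp [hNa]
    simp only [Set.ofPred_forall] at hcl ⊢
    exact isClosed_iInter fun a => isClosed_iInter fun b => hcl a b
  · rw [div_le_one (by positivity)]
    exact (Real.rpow_le_one hκ0.le hκ1 (Finset.sum_nonneg fun i _ => (hτ i).le)).trans hR
  · obtain ⟨H₀, hH₀⟩ := eventually_atTop.1 (eventually_all.2 fun i =>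
      (tendsto_rpow_atTop (hτ i)).eventually_gt_atTop (R / r))
    obtain ⟨H, hH, hH1, hcov⟩ := hcov (max H₀ N)
    have hHN : N < H := (le_max_right _ _).trans_lt hH
    have hH0 : 0 < H := by linarith
    refine ⟨fun i => R / H ^ τ i, fun i => ⟨by positivity, ?_⟩, fun x => ?_⟩
    · have := hH₀ H ((le_max_left _ _).trans hH.le) i
      rwa [div_lt_comm₀ (by positivity) hr]
    · obtain ⟨a, b, hab, ha⟩ := hcov x
      refine ⟨fun i => ∑ j, (a j : ℝ) * α j i - b i, fun i => ?_, fun y hy hyF => ?_⟩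
      · rw [le_div_iff₀ (by positivity), mul_comm]
        exact hab i
      · have hHa : H ≤ quasiNorm η (fun j => (a j : ℝ)) := by
          by_contra! hlt
          have h1 := (quasiNorm_lt_iff hη hH0.le).1 hlt ⟨0, hm⟩
          exact absurd ((le_abs_self _).trans_lt h1) (not_lt.2 (ha _).1)
        have haC : quasiNorm η (fun j => (a j : ℝ)) ≤ C * H := by
          rw [quasiNorm_le_iff hη (by positivity)]
          intro j
          have hpos : 0 < H ^ η j := by positivity
          rw [abs_of_nonneg (hpos.le.trans (ha j).1), Real.mul_rpow (by positivity) hH0.le]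
          refine (ha j).2.trans (mul_le_mul_of_nonneg_right ?_ hpos.le)
          rw [← Real.rpow_inv_le_iff_of_pos (by positivity) (by positivity) (hη j), ← one_div]
          exact hCj j
        refine absurd (hyF a b (hHN.trans_le hHa)) (not_le.2 ?_)
        rw [quasiNorm_lt_iff hτ (div_nonneg hε.le (quasiNorm_nonneg _ _))]
        intro i
        rw [abs_sub_comm]
        calc |y i - (∑ j, (a j : ℝ) * α j i - b i)|
            < κ ^ (∑ i, τ i) / R * (R / H ^ τ i) := hy i
          _ = κ ^ (∑ i, τ i) / H ^ τ i := div_mul_div_cancel₀ (by positivity)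
          _ ≤ κ ^ τ i / H ^ τ i := div_le_div_of_nonneg_right
              (Real.rpow_le_rpow_of_exponent_ge hκ0 hκ1
                (Finset.single_le_sum (fun i _ => (hτ i).le) (Finset.mem_univ i))) (by positivity)
          _ = (κ / H) ^ τ i := (Real.div_rpow hκ0.le hH0.le _).symm
          _ ≤ (ε / quasiNorm η fun j => (a j : ℝ)) ^ τ i := by
              refine Real.rpow_le_rpow (by positivity) ?_ (hτ i).le
              calc κ / H ≤ ε / C / H := div_le_div_of_nonneg_right hκε hH0.le
                _ = ε / (C * H) := div_div _ _ _
                _ ≤ _ := div_le_div_of_nonneg_left hε.le (hH0.trans_le hHa) haC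

end

/-- The weighted Kim–Shapira theorem, liminf form: for a.e. `γ`,
`liminf_{|a|_η → ∞} |a|_η · min_b |aα - b - γ|_τ = 0`. -/
theorem weighted_kim_shapira_liminf (m n : ℕ) (hm : 0 < m) (hn : 0 < n)
    (τ : Fin n → ℝ) (η : Fin m → ℝ)
    (hτ : ∀ i, 0 < τ i) (hη : ∀ j, 0 < η j)
    (hw : ∑ i, τ i = ∑ j, η j)
    (α : Matrix (Fin m) (Fin n) ℝ) (hα : ¬ IsSingular τ η α) :
    ∀ᵐ γ ∂(MeasureTheory.volume : MeasureTheory.Measure (Fin n → ℝ)),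
      ∀ ε > (0 : ℝ), ∀ N > (0 : ℝ), ∃ a : Fin m → ℤ,
        quasiNorm η (fun j => (a j : ℝ)) > N ∧
        quasiNorm η (fun j => (a j : ℝ)) *
          (⨅ b : Fin n → ℤ,
            quasiNorm τ (fun i => (∑ j, (a j : ℝ) * α j i) - (b i : ℝ) - γ i)) < ε := by
  have hnull (p : ℕ × ℕ) := volume_setOf_not_approximable_eq_zero hm hn hτ hη hw hα
    (ε := 1 / ((p.1 : ℝ) + 1)) (N := (p.2 : ℝ) + 1) (by positivity) (by positivity)
  filter_upwards [MeasureTheory.ae_all_iff.2 fun p => MeasureTheory.measure_eq_zero_iff_ae_notMem.1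
    (hnull p)] with γ hγ ε hε N hN
  obtain ⟨k, hk⟩ := exists_nat_one_div_lt hε
  obtain ⟨l, hl⟩ := exists_nat_gt N
  have hkl := hγ (k, l)
  push Not at hkl
  obtain ⟨a, b, ha, hab⟩ := hkl
  have hNa : N < quasiNorm η (fun j => (a j : ℝ)) := by linarith
  refine ⟨a, hNa, ?_⟩
  have hbdd : BddBelow (Set.range fun b : Fin n → ℤ =>
      quasiNorm τ (fun i => (∑ j, (a j : ℝ) * α j i) - (b i : ℝ) - γ i)) :=
    ⟨0, by
      rintro _ ⟨b, rfl⟩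
      exact quasiNorm_nonneg _ _⟩
  have hpos := hN.trans hNa
  have hlt := (ciInf_le hbdd b).trans_lt hab
  rw [lt_div_iff₀ hpos, mul_comm] at hlt
  exact hlt.trans hk
end

section
/- Suppose every place in S is finite and let α ∈ ℤ_S^{m×n} be (τ,η)-non-singular. Then there exist ε > 0 and arbitrarily large H > 1 with the following property: setting C_0 := ε^{-(m+n)} Π_{ν∈S} ν^{m+2n}, there exist m + n linearly independent vectors (a^{(1)}, b^{(1)}), …, (a^{(m+n)}, b^{(m+n)}) ∈ ℤ^{m+n} such that for each ℓ: |a^{(ℓ)}α + b^{(ℓ)}|_τ < ε H^{-1}; |a^{(ℓ)}_j| ≤ C_0 H^{η_j} for 1 ≤ j ≤ m; |b^{(ℓ)}_i| ≤ C_0 H^{η_{m+i}} for 1 ≤ i ≤ n; and every coordinate c of (a^{(ℓ)}, b^{(ℓ)}) satisfies |c|_ν ≤ 1/ν for every ν ∈ S. -/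
instance (q : Nat.Primes) : Fact (Nat.Prime (q : ℕ)) := ⟨q.2⟩

variable (m n : ℕ) (S : Finset Nat.Primes)

/-- The `τ`-semi-norm of a point of `ℚ_S^n` when `∞ ∉ S`. -/
noncomputable def tauNormFin (τ : Fin n → {ν // ν ∈ S} → ℝ)
    (x : ∀ ν : {ν // ν ∈ S}, Fin n → ℚ_[(ν : Nat.Primes)]) : ℝ :=
  ⨆ ν, ⨆ i, ‖x ν i‖ ^ (1 / τ i ν)

/-- `|(a,b)|_η = max_{ℓ ≤ m+n} |c_ℓ|^{1/η_ℓ}` where `c = (a₁,…,a_m,b₁,…,b_n)`. -/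
noncomputable def etaNormPair (η : Fin (m + n) → ℝ) (a : Fin m → ℤ) (b : Fin n → ℤ) : ℝ :=
  ⨆ ℓ, |((Fin.append a b ℓ : ℤ) : ℝ)| ^ (1 / η ℓ)

/-- `(τ,η)`-singularity of `α ∈ ℚ_S^{m×n}` in the case `∞ ∉ S`. -/
def IsSingularSFin (τ : Fin n → {ν // ν ∈ S} → ℝ) (η : Fin (m + n) → ℝ)
    (α : ∀ ν : {ν // ν ∈ S}, Fin n → Fin m → ℚ_[(ν : Nat.Primes)]) : Prop :=
  ∀ ε > (0 : ℝ), ∃ H₀ : ℝ, ∀ H > H₀, ∃ (a : Fin m → ℤ) (b : Fin n → ℤ), ¬(a = 0 ∧ b = 0) ∧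
    tauNormFin n S τ
      (fun ν i => (∑ j, (a j : ℚ_[(ν : Nat.Primes)]) * α ν i j)
        - (b i : ℚ_[(ν : Nat.Primes)])) < ε * H⁻¹ ∧
    etaNormPair m n η a b ≤ H

/-- A set of integer vectors annihilated by no nonzero real linear form contains a linearly
independent family of full size. -/
theorem exists_linearIndependent_of_forall_form_eq_zero {ι : Type*} [Fintype ι]
    (D : Set (ι → ℤ))
    (h : ∀ c : ι → ℝ, (∀ x ∈ D, ∑ j, c j * (x j : ℝ) = 0) → c = 0) :
    ∃ v : ι → ι → ℤ, (∀ i, v i ∈ D) ∧ LinearIndependent ℤ v := by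
  classical
  let castHom : (ι → ℤ) →ₗ[ℤ] (ι → ℝ) :=
    { toFun := fun x j => (x j : ℝ)
      map_add' := fun x y => by ext j; simp
      map_smul' := fun r x => by ext j; simp }
  have hspan : Submodule.span ℝ (castHom '' D) = ⊤ := by
    by_contra hne
    obtain ⟨φ, hφ, hker⟩ := Submodule.exists_le_ker_of_lt_top _ (lt_top_iff_ne_top.2 hne)
    apply hφ
    have hc := h (fun i => φ (fun j => if i = j then 1 else 0)) fun x hx => by
      have h0 : φ (castHom x) = 0 :=
        hker (Submodule.subset_span (Set.mem_image_of_mem _ hx))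
      rw [LinearMap.pi_apply_eq_sum_univ] at h0
      refine Eq.trans (Finset.sum_congr rfl fun i _ => ?_) h0
      rw [smul_eq_mul, mul_comm]
      rfl
    ext1
    refine LinearMap.ext fun x => ?_
    simp only [LinearMap.comp_apply]
    rw [LinearMap.pi_apply_eq_sum_univ]
    simp only [funext_iff, Pi.zero_apply] at hc
    simp [hc]
  obtain ⟨b, hbD, hb, hli⟩ := exists_linearIndependent ℝ (castHom '' D)
  let bas : Module.Basis b ℝ (ι → ℝ) :=
    Module.Basis.mk hli (by rw [Subtype.range_coe, hb, hspan])
  let e : ι ≃ b := (Pi.basisFun ℝ ι).indexEquiv bas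
  choose v hvD hv using fun i => hbD (e i).2
  refine ⟨v, hvD, LinearIndependent.of_comp castHom ?_⟩
  have hcomp : castHom ∘ v = (Subtype.val : b → ι → ℝ) ∘ e := funext hv
  rw [hcomp]
  refine LinearIndependent.restrict_scalars (R := ℤ) (K := ℝ) ?_ (hli.comp e e.injective)
  intro x y hxy
  simpa using hxy

/-- On a hyperplane, some coordinate is controlled by the others, relative to given scales. -/
theorem exists_coordinate_le_of_form_eq_zero {ι : Type*} [Fintype ι] {c : ι → ℝ} (hc : c ≠ 0)
    {B : ι → ℝ} (hB : ∀ j, 0 < B j) :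
    ∃ j₀, ∀ x : ι → ℝ, ∑ j, c j * x j = 0 →
      (∀ j ≠ j₀, |x j| ≤ B j / Fintype.card ι) → |x j₀| ≤ B j₀ := by
  classical
  obtain ⟨k, hk⟩ := Function.ne_iff.1 hc
  obtain ⟨j₀, -, hj₀⟩ := Finset.exists_max_image Finset.univ (fun j => |c j| * B j) ⟨k, by simp⟩
  have hpos : 0 < |c j₀| * B j₀ :=
    (mul_pos (abs_pos.2 hk) (hB k)).trans_le (hj₀ k (by simp))
  have hc₀ : 0 < |c j₀| := pos_of_mul_pos_left hpos (hB j₀).le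
  have hcard : (0 : ℝ) < Fintype.card ι := by
    exact_mod_cast Fintype.card_pos_iff.2 ⟨k⟩
  refine ⟨j₀, fun x hx hsmall => ?_⟩
  rw [← Finset.add_sum_erase _ _ (Finset.mem_univ j₀)] at hx
  have hx' : c j₀ * x j₀ = -∑ j ∈ Finset.univ.erase j₀, c j * x j := by linarith
  refine le_of_mul_le_mul_left ?_ hc₀
  calc |c j₀| * |x j₀| = |∑ j ∈ Finset.univ.erase j₀, c j * x j| := by
        rw [← abs_mul, hx', abs_neg]
    _ ≤ ∑ j ∈ Finset.univ.erase j₀, |c j * x j| := Finset.abs_sum_le_sum_abs _ _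
    _ ≤ ∑ j ∈ Finset.univ.erase j₀, |c j₀| * B j₀ / Fintype.card ι := by
        refine Finset.sum_le_sum fun j hj => ?_
        rw [abs_mul]
        calc |c j| * |x j| ≤ |c j| * (B j / Fintype.card ι) := by
              gcongr; exact hsmall j (Finset.ne_of_mem_erase hj)
          _ = |c j| * B j / Fintype.card ι := by ring
          _ ≤ _ := div_le_div_of_nonneg_right (hj₀ j (Finset.mem_univ j)) hcard.le
    _ ≤ ∑ _j : ι, |c j₀| * B j₀ / Fintype.card ι :=
        Finset.sum_le_sum_of_subset_of_nonneg (Finset.erase_subset _ _)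
          fun _ _ _ => by positivity
    _ = |c j₀| * B j₀ := by
        rw [Finset.sum_const, Finset.card_univ, nsmul_eq_mul]; field_simp

/-- A qualitative form of Minkowski's second theorem: if differences of points in the same fibre of
a map to a finite set of size `≪ ∏ B j` lie in `L`, and `L` has no nonzero point in the box of
side lengths `B`, then a bounded dilate of this box contains a full set of linearly independent
points of `L`. -/
theorem exists_linearIndependent_in_dilated_box {ι : Type*} [Fintype ι] [Nonempty ι] (C : ℝ) :
    ∃ K : ℝ, 0 < K ∧ ∀ (B : ι → ℝ), (∀ j, 1 ≤ B j) → ∀ (Q : Type) [Fintype Q]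
      (f : (ι → ℤ) → Q) (L : Set (ι → ℤ)), (∀ x y, f x = f y → x - y ∈ L) →
      (Fintype.card Q : ℝ) ≤ C * ∏ j, B j →
      (∀ x ∈ L, (∀ j, |(x j : ℝ)| ≤ B j) → x = 0) →
      ∃ v : ι → ι → ℤ, LinearIndependent ℤ v ∧ ∀ i, v i ∈ L ∧ ∀ j, |(v i j : ℝ)| ≤ K * B j := by
  classical
  set w := Fintype.card ι with hw
  have hwpos : 0 < w := Fintype.card_pos
  obtain ⟨R, hR⟩ := exists_nat_gt (max 1 (C * (2 * w) ^ (w - 1) : ℝ))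
  have hR1 : (1 : ℝ) < R := (le_max_left _ _).trans_lt hR
  have hRC : C * (2 * w) ^ (w - 1) < R := (le_max_right _ _).trans_lt hR
  refine ⟨R + 1, by positivity, fun B hB Q _ f L hL hQ hbox => ?_⟩
  have hBpos : ∀ j, 0 < B j := fun j => one_pos.trans_le (hB j)
  have hprod : 0 < ∏ j, B j := Finset.prod_pos fun j _ => hBpos j
  have hQpos : (0 : ℝ) < Fintype.card Q := by
    exact_mod_cast Fintype.card_pos_iff.2 ⟨f 0⟩
  have hC : 0 < C := pos_of_mul_pos_left (hQpos.trans_le hQ) hprod.le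
  let N : ι → ℤ := fun j => ⌈R * B j⌉
  have hN : ∀ j, (N j : ℝ) < (R + 1) * B j := fun j =>
    (Int.ceil_lt_add_one _).trans_le (by linarith [hB j])
  let F : Finset (ι → ℤ) := Fintype.piFinset fun j => Finset.Ico 0 (N j)
  have hF : (R : ℝ) ^ w * ∏ j, B j ≤ F.card := by
    rw [Fintype.card_piFinset, hw, ← Finset.card_univ, ← Finset.prod_const,
      ← Finset.prod_mul_distrib]
    push_cast
    refine Finset.prod_le_prod (fun j _ => by have := hBpos j; positivity) fun j _ => ?_
    rw [Int.card_Ico, sub_zero]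
    have h1 : (R : ℝ) * B j ≤ N j := Int.le_ceil _
    have h2 : (N j : ℝ) ≤ ((N j).toNat : ℝ) := by exact_mod_cast Int.self_le_toNat (N j)
    exact h1.trans h2
  obtain ⟨q, -, hq⟩ := Finset.exists_le_card_fiber_of_nsmul_le_card_of_maps_to
    (s := F) (t := Finset.univ) (f := f) (b := (R : ℝ) ^ w / C) (fun _ _ => Finset.mem_univ _)
    ⟨f 0, Finset.mem_univ _⟩ (by
      rw [nsmul_eq_mul, Finset.card_univ]
      refine le_trans ?_ hF
      calc (Fintype.card Q : ℝ) * (R ^ w / C) ≤ (C * ∏ j, B j) * (R ^ w / C) := by gcongr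
        _ = R ^ w * ∏ j, B j := by field_simp)
  let T := F.filter fun x => f x = q
  have hmemF : ∀ x ∈ T, ∀ j, (0 : ℝ) ≤ x j ∧ (x j : ℝ) < (R + 1) * B j := fun x hx j => by
    have := Fintype.mem_piFinset.1 (Finset.mem_filter.1 hx).1 j
    rw [Finset.mem_Ico] at this
    exact ⟨by exact_mod_cast this.1, lt_trans (by exact_mod_cast this.2) (hN j)⟩
  have hdiff : ∀ x ∈ T, ∀ y ∈ T,
      x - y ∈ {z : ι → ℤ | z ∈ L ∧ ∀ j, |(z j : ℝ)| ≤ (R + 1) * B j} := fun x hx y hy => by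
    refine ⟨hL x y ?_, fun j => ?_⟩
    · rw [(Finset.mem_filter.1 hx).2, (Finset.mem_filter.1 hy).2]
    · obtain ⟨h1, h2⟩ := hmemF x hx j
      obtain ⟨h3, h4⟩ := hmemF y hy j
      rw [Pi.sub_apply, Int.cast_sub, abs_le]
      constructor <;> linarith
  obtain ⟨v, hv, hli⟩ := exists_linearIndependent_of_forall_form_eq_zero
    {z : ι → ℤ | z ∈ L ∧ ∀ j, |(z j : ℝ)| ≤ (R + 1) * B j} (fun c hc => by
      by_contra hne
      obtain ⟨j₀, hj₀⟩ := exists_coordinate_le_of_form_eq_zero hne hBpos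
      let g : (ι → ℤ) → ({j // j ≠ j₀} → ℤ) := fun x j => ⌊w * (x j : ℝ) / B j⌋
      have hmaps : ∀ x ∈ T, g x ∈
          Fintype.piFinset fun _ : {j // j ≠ j₀} => Finset.Ico (0 : ℤ) ((w * (R + 1) : ℕ) : ℤ) := by
        intro x hx
        rw [Fintype.mem_piFinset]
        intro j
        obtain ⟨h1, h2⟩ := hmemF x hx j
        have hb := hBpos j
        rw [Finset.mem_Ico]
        refine ⟨Int.floor_nonneg.2 (by positivity), Int.floor_lt.2 ?_⟩
        rw [div_lt_iff₀ hb]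
        push_cast
        rw [mul_assoc]
        have : (0 : ℝ) < w := by exact_mod_cast hwpos
        gcongr
      have hinj : Set.InjOn g T := by
        intro x hx y hy hxy
        have hD := hdiff x hx y hy
        rw [← sub_eq_zero]
        have hsmall : ∀ j ≠ j₀, |((x - y) j : ℝ)| ≤ B j / w := fun j hj => by
          have h1 := Int.abs_sub_lt_one_of_floor_eq_floor (congrFun hxy ⟨j, hj⟩)
          have hb := hBpos j
          have hw0 : (0 : ℝ) < w := by exact_mod_cast hwpos
          simp only at h1
          rw [← sub_div, ← mul_sub, abs_div, abs_mul, abs_of_pos hb, abs_of_pos hw0,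
            div_lt_one hb] at h1
          rw [le_div_iff₀ hw0, Pi.sub_apply, Int.cast_sub, mul_comm]
          exact h1.le
        refine hbox _ hD.1 fun j => ?_
        by_cases hj : j = j₀
        · rw [hj]
          exact hj₀ (fun j => ((x - y) j : ℝ)) (hc _ hD) hsmall
        · refine (hsmall j hj).trans (div_le_self (hBpos j).le ?_)
          exact_mod_cast hwpos
      have hcard := Finset.card_le_card_of_injOn g hmaps hinj
      rw [Fintype.card_piFinset, Finset.prod_const, Finset.card_univ, Int.card_Ico, sub_zero, Int.toNat_natCast,
        Fintype.card_subtype_compl, Fintype.card_subtype_eq, ← hw] at hcard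
      have hcard' : (T.card : ℝ) ≤ (w * (R + 1)) ^ (w - 1) := by exact_mod_cast hcard
      have h3 := hq.trans hcard'
      rw [div_le_iff₀ hC] at h3
      have h4 : ((w : ℝ) * (R + 1)) ^ (w - 1) ≤ ((2 * w) * R) ^ (w - 1) := by
        refine pow_le_pow_left₀ (by positivity) ?_ _
        have : (1 : ℝ) ≤ w := by exact_mod_cast hwpos
        nlinarith
      have h5 : (R : ℝ) ^ w = R * R ^ (w - 1) := by
        rw [← pow_succ', Nat.sub_add_cancel hwpos]
      have h6 : (0 : ℝ) < R ^ (w - 1) := by positivity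
      rw [mul_pow (2 * (w : ℝ))] at h4
      have h7 := mul_lt_mul_of_pos_right hRC h6
      have h8 := mul_le_mul_of_nonneg_right h4 hC.le
      rw [h5] at h3
      linarith)
  exact ⟨v, hli, hv⟩

theorem norm_sub_le_of_toZModPow_eq {p : ℕ} [Fact p.Prime] {k : ℕ} {x y : ℤ_[p]}
    (h : PadicInt.toZModPow k x = PadicInt.toZModPow k y) : ‖x - y‖ ≤ (p : ℝ) ^ (-(k : ℤ)) := by
  rw [PadicInt.norm_le_pow_iff_mem_span_pow, ← PadicInt.ker_toZModPow, RingHom.mem_ker, map_sub,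
    h, sub_self]

theorem exists_nat_pow_inv_lt {p δ : ℝ} (hp : 1 < p) (hδ : 0 < δ) (hδ1 : δ ≤ 1) :
    ∃ k : ℕ, p ^ (-(k : ℤ)) < δ ∧ p ^ k ≤ p / δ := by
  obtain ⟨k, hk1, hk2⟩ := exists_nat_pow_near ((one_le_inv₀ hδ).2 hδ1) hp
  have hp0 : 0 < p := one_pos.trans hp
  refine ⟨k + 1, ?_, ?_⟩
  · rw [zpow_neg, zpow_natCast]
    exact inv_lt_of_inv_lt₀ hδ hk2
  · rw [pow_succ', div_eq_mul_inv]
    gcongr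

theorem tauNormFin_lt_iff {n : ℕ} {S : Finset Nat.Primes} (hn : 0 < n) (hS : S.Nonempty)
    {τ : Fin n → {ν // ν ∈ S} → ℝ} (hτ : ∀ i ν, 0 < τ i ν)
    {x : ∀ ν : {ν // ν ∈ S}, Fin n → ℚ_[(ν : Nat.Primes)]} {t : ℝ} (ht : 0 < t) :
    tauNormFin n S τ x < t ↔ ∀ ν i, ‖x ν i‖ < t ^ τ i ν := by
  have : Nonempty (Fin n) := ⟨⟨0, hn⟩⟩
  have : Nonempty {ν // ν ∈ S} := hS.to_subtype
  have key : ∀ ν i, ‖x ν i‖ ^ (1 / τ i ν) < t ↔ ‖x ν i‖ < t ^ τ i ν := fun ν i => by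
    rw [one_div]
    exact Real.rpow_inv_lt_iff_of_pos (norm_nonneg _) ht.le (hτ i ν)
  unfold tauNormFin
  constructor
  · intro h ν i
    refine (key ν i).1 (lt_of_le_of_lt ?_ h)
    exact (le_ciSup (f := fun i => ‖x ν i‖ ^ (1 / τ i ν)) (Set.finite_range _).bddAbove i).trans
      (le_ciSup (f := fun ν => ⨆ i, ‖x ν i‖ ^ (1 / τ i ν)) (Set.finite_range _).bddAbove ν)
  · intro h
    obtain ⟨ν, hν⟩ := exists_eq_ciSup_of_finite (f := fun ν => ⨆ i, ‖x ν i‖ ^ (1 / τ i ν))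
    obtain ⟨i, hi⟩ := exists_eq_ciSup_of_finite (f := fun i => ‖x ν i‖ ^ (1 / τ i ν))
    rw [← hν, ← hi]
    exact (key ν i).2 (h ν i)

theorem etaNormPair_le {m n : ℕ} (hm : 0 < m) {η : Fin (m + n) → ℝ} (hη : ∀ ℓ, 0 < η ℓ)
    {x : Fin (m + n) → ℤ} {H : ℝ} (hH : 0 ≤ H) (h : ∀ ℓ, |(x ℓ : ℝ)| ≤ H ^ η ℓ) :
    etaNormPair m n η (fun j => x (Fin.castAdd n j)) (fun i => x (Fin.natAdd m i)) ≤ H := by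
  have : Nonempty (Fin (m + n)) := ⟨⟨0, by omega⟩⟩
  unfold etaNormPair
  refine ciSup_le fun ℓ => ?_
  rw [Fin.append_castAdd_natAdd (f := x), one_div]
  exact (Real.rpow_inv_le_iff_of_pos (abs_nonneg _) hH (hη ℓ)).2 (h ℓ)

/-- The value `aα - b` at the integer vector `x = (a, b)`. -/
noncomputable def linearFormValue {m n : ℕ} {S : Finset Nat.Primes}
    (α : ∀ ν : {ν // ν ∈ S}, Fin n → Fin m → ℚ_[(ν : Nat.Primes)]) (x : Fin (m + n) → ℤ)
    (ν : {ν // ν ∈ S}) (i : Fin n) : ℚ_[(ν : Nat.Primes)] :=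
  (∑ j, (x (Fin.castAdd n j) : ℚ_[(ν : Nat.Primes)]) * α ν i j)
    - (x (Fin.natAdd m i) : ℚ_[(ν : Nat.Primes)])

theorem linearFormValue_sub {m n : ℕ} {S : Finset Nat.Primes}
    (α : ∀ ν : {ν // ν ∈ S}, Fin n → Fin m → ℚ_[(ν : Nat.Primes)]) (x y : Fin (m + n) → ℤ)
    (ν : {ν // ν ∈ S}) (i : Fin n) :
    linearFormValue α (x - y) ν i = linearFormValue α x ν i - linearFormValue α y ν i := by
  simp only [linearFormValue, Pi.sub_apply, Int.cast_sub, sub_mul, Finset.sum_sub_distrib]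
  ring

theorem norm_linearFormValue_le_one {m n : ℕ} {S : Finset Nat.Primes}
    {α : ∀ ν : {ν // ν ∈ S}, Fin n → Fin m → ℚ_[(ν : Nat.Primes)]} (hα : ∀ ν i j, ‖α ν i j‖ ≤ 1)
    (x : Fin (m + n) → ℤ) (ν : {ν // ν ∈ S}) (i : Fin n) : ‖linearFormValue α x ν i‖ ≤ 1 := by
  let a : Fin m → ℤ_[(ν : Nat.Primes)] := fun j => ⟨α ν i j, hα ν i j⟩
  have h : linearFormValue α x ν i =
      (((∑ j, (x (Fin.castAdd n j) : ℤ_[(ν : Nat.Primes)]) * a j)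
        - (x (Fin.natAdd m i) : ℤ_[(ν : Nat.Primes)]) : ℤ_[(ν : Nat.Primes)]) :
          ℚ_[(ν : Nat.Primes)]) := by
    rw [PadicInt.coe_sub, PadicInt.coe_sum, PadicInt.coe_intCast]
    simp only [PadicInt.coe_mul, PadicInt.coe_intCast]
    rfl
  rw [h]
  exact PadicInt.norm_le_one _

/-- Vectors of integers can be sorted into `≪ t⁻¹ ^ (m + n)` classes within which the values
`aα - b` are `t`-close in the `τ`-norm. -/
theorem exists_classes_tauNormFin_lt {m n : ℕ} {S : Finset Nat.Primes} (hn : 0 < n)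
    (hS : S.Nonempty) {τ : Fin n → {ν // ν ∈ S} → ℝ} (hτ : ∀ i ν, 0 < τ i ν)
    (hτsum : ∑ i, ∑ ν : {ν // ν ∈ S}, τ i ν = (m + n : ℝ))
    {α : ∀ ν : {ν // ν ∈ S}, Fin n → Fin m → ℚ_[(ν : Nat.Primes)]} (hα : ∀ ν i j, ‖α ν i j‖ ≤ 1)
    {t : ℝ} (ht : 0 < t) (ht1 : t ≤ 1) :
    ∃ (Q : Type) (_ : Fintype Q) (f : (Fin (m + n) → ℤ) → Q),
      (∀ x y, f x = f y → tauNormFin n S τ (linearFormValue α (x - y)) < t) ∧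
      (Fintype.card Q : ℝ) ≤ (∏ ν : {ν // ν ∈ S}, (((ν : Nat.Primes) : ℕ) : ℝ) ^ n) * t⁻¹ ^ (m + n) := by
  have hp : ∀ ν : {ν // ν ∈ S}, (1 : ℝ) < ((ν : Nat.Primes) : ℕ) := fun ν => by
    exact_mod_cast (ν : Nat.Primes).2.one_lt
  have hδ : ∀ i ν, 0 < t ^ τ i ν := fun i ν => Real.rpow_pos_of_pos ht _
  choose k hk1 hk2 using fun ν i => exists_nat_pow_inv_lt (hp ν) (hδ i ν)
    (Real.rpow_le_one ht.le ht1 (hτ i ν).le)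
  have hne : ∀ (ν : {ν // ν ∈ S}) i, NeZero (((ν : Nat.Primes) : ℕ) ^ k ν i) := fun ν i =>
    ⟨pow_ne_zero _ (ν : Nat.Primes).2.ne_zero⟩
  refine ⟨∀ (ν : {ν // ν ∈ S}) (i : Fin n), ZMod (((ν : Nat.Primes) : ℕ) ^ k ν i), inferInstance,
    fun x ν i => PadicInt.toZModPow (k ν i)
      ⟨linearFormValue α x ν i, norm_linearFormValue_le_one hα x ν i⟩, fun x y hxy => ?_, ?_⟩
  · refine (tauNormFin_lt_iff hn hS hτ ht).2 fun ν i => lt_of_le_of_lt ?_ (hk1 ν i)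
    rw [linearFormValue_sub]
    exact norm_sub_le_of_toZModPow_eq (congrFun (congrFun hxy ν) i)
  · simp only [Fintype.card_pi, ZMod.card]
    push_cast
    calc ∏ ν : {ν // ν ∈ S}, ∏ i, (((ν : Nat.Primes) : ℕ) : ℝ) ^ k ν i
        ≤ ∏ ν : {ν // ν ∈ S}, ∏ i, ((((ν : Nat.Primes) : ℕ) : ℝ) * t⁻¹ ^ τ i ν) := by
          refine Finset.prod_le_prod (fun _ _ => by positivity) fun ν _ =>
            Finset.prod_le_prod (fun _ _ => by positivity) fun i _ => (hk2 ν i).trans_eq ?_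
          rw [Real.inv_rpow ht.le, div_eq_mul_inv]
      _ = _ := by
          simp only [Finset.prod_mul_distrib, Finset.prod_const, Finset.card_univ, Fintype.card_fin]
          congr 1
          simp only [← Real.rpow_sum_of_pos (inv_pos.2 ht)]
          rw [Finset.sum_comm, hτsum, ← Real.rpow_natCast]
          push_cast
          rfl

/-- The map `(a, b) ↦ (P a, -P b)`. -/
def scaleSplit (m n : ℕ) (P : ℤ) : (Fin (m + n) → ℤ) →ₗ[ℤ] (Fin m → ℤ) × (Fin n → ℤ) where
  toFun x := (fun j => P * x (Fin.castAdd n j), fun i => -(P * x (Fin.natAdd m i)))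
  map_add' x y := by
    ext <;> simp only [Pi.add_apply, Prod.fst_add, Prod.snd_add] <;> ring
  map_smul' r x := by
    ext <;> simp only [Pi.smul_apply, Prod.smul_fst, Prod.smul_snd, smul_eq_mul,
      RingHom.id_apply] <;> ring

theorem ker_scaleSplit {m n : ℕ} {P : ℤ} (hP : P ≠ 0) : (scaleSplit m n P).ker = ⊥ := by
  refine LinearMap.ker_eq_bot'.2 fun x hx => funext fun ℓ => ?_
  have h1 := congrArg Prod.fst hx
  have h2 := congrArg Prod.snd hx
  refine Fin.addCases (fun j => ?_) (fun i => ?_) ℓ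
  · exact (mul_eq_zero.1 (congrFun h1 j)).resolve_left hP
  · exact (mul_eq_zero.1 (neg_eq_zero.1 (congrFun h2 i))).resolve_left hP

theorem exists_pos_forall_le_mul_rpow {k : Type*} [Finite k] {N : ℕ} {η : k → ℝ}
    (hη : ∀ ℓ, η ℓ < N) {ε : ℝ} (hε : 0 < ε) (M : ℝ) :
    ∃ s : ℝ, 0 < s ∧ ∀ ℓ, M ≤ (s * ε)⁻¹ ^ N * s ^ η ℓ := by
  have h : ∀ ℓ, ∀ᶠ s : ℝ in nhdsWithin 0 (Set.Ioi 0), M * ε ^ N ≤ s ^ (η ℓ - N) := fun ℓ =>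
    (tendsto_rpow_neg_nhdsGT_zero (sub_neg.2 (hη ℓ))).eventually_ge_atTop _
  obtain ⟨s, hs, hs0⟩ := ((Filter.eventually_all.2 h).and self_mem_nhdsWithin).exists
  have hs0 : 0 < s := hs0
  refine ⟨s, hs0, fun ℓ => ?_⟩
  have h1 := hs ℓ
  rw [Real.rpow_sub hs0, Real.rpow_natCast, ← le_div_iff₀ (by positivity)] at h1
  refine h1.trans_eq ?_
  rw [inv_pow, mul_pow]
  field_simp

/-- For a `(τ,η)`-non-singular `α ∈ ℤ_S^{m×n}` (case `∞ ∉ S`), there exist `ε > 0`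
and arbitrarily large `H` admitting `m+n` linearly independent integer vectors
satisfying the stated bounds, with `C₀ = ε^{-(m+n)} ∏_{ν∈S} ν^{m+2n}`. -/
theorem nonsingular_linearly_independent_vectors
    (hm : 0 < m) (hn : 0 < n) (hS : S.Nonempty)
    (τ : Fin n → {ν // ν ∈ S} → ℝ) (η : Fin (m + n) → ℝ)
    (hτ : ∀ i ν, 0 < τ i ν) (hη : ∀ ℓ, 0 < η ℓ)
    (hτsum : ∑ i, ∑ ν : {ν // ν ∈ S}, τ i ν = (m + n : ℝ))
    (hηsum : ∑ ℓ, η ℓ = (m + n : ℝ))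
    (α : ∀ ν : {ν // ν ∈ S}, Fin n → Fin m → ℚ_[(ν : Nat.Primes)])
    (hαint : ∀ ν i j, ‖α ν i j‖ ≤ 1)
    (hα : ¬ IsSingularSFin m n S τ η α) :
    ∃ ε : ℝ, 0 < ε ∧ ∀ T : ℝ, ∃ H : ℝ, 1 < H ∧ T < H ∧
      ∃ v : Fin (m + n) → (Fin m → ℤ) × (Fin n → ℤ),
        LinearIndependent ℤ v ∧
        ∀ ℓ,
          tauNormFin n S τ
            (fun ν i => (∑ j, ((v ℓ).1 j : ℚ_[(ν : Nat.Primes)]) * α ν i j)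
              + ((v ℓ).2 i : ℚ_[(ν : Nat.Primes)])) < ε * H⁻¹ ∧
          (∀ j : Fin m, |((v ℓ).1 j : ℝ)| ≤
            (ε⁻¹ ^ (m + n) * ∏ ν ∈ S, ((ν : ℕ) : ℝ) ^ (m + 2 * n)) * H ^ η (Fin.castAdd n j)) ∧
          (∀ i : Fin n, |((v ℓ).2 i : ℝ)| ≤
            (ε⁻¹ ^ (m + n) * ∏ ν ∈ S, ((ν : ℕ) : ℝ) ^ (m + 2 * n)) * H ^ η (Fin.natAdd m i)) ∧
          (∀ ν : {ν // ν ∈ S},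
            (∀ j, ‖(((v ℓ).1 j : ℤ) : ℚ_[(ν : Nat.Primes)])‖ ≤ (((ν : Nat.Primes) : ℕ) : ℝ)⁻¹) ∧
            (∀ i, ‖(((v ℓ).2 i : ℤ) : ℚ_[(ν : Nat.Primes)])‖ ≤ (((ν : Nat.Primes) : ℕ) : ℝ)⁻¹)) := by
  have : Nonempty (Fin (m + n)) := ⟨⟨0, by omega⟩⟩
  have hη_lt : ∀ ℓ, η ℓ < (m + n : ℕ) := fun ℓ => by
    have : Nontrivial (Fin (m + n)) := Fin.nontrivial_iff_two_le.2 (by omega)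
    obtain ⟨ℓ', hne⟩ := exists_ne ℓ
    rw [Nat.cast_add, ← hηsum]
    exact Finset.single_lt_sum hne (Finset.mem_univ _) (Finset.mem_univ _) (hη ℓ')
      fun k _ _ => (hη k).le
  have hprime : ∀ ν : Nat.Primes, (1 : ℝ) ≤ (ν : ℕ) := fun ν => by
    exact_mod_cast ν.2.one_lt.le
  unfold IsSingularSFin at hα
  push Not at hα
  obtain ⟨ε₀, hε₀, hα⟩ := hα
  obtain ⟨K, hK, hbox⟩ := exists_linearIndependent_in_dilated_box (ι := Fin (m + n))
    ((∏ ν : {ν // ν ∈ S}, (((ν : Nat.Primes) : ℕ) : ℝ) ^ n) * ε₀⁻¹ ^ (m + n))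
  let P : ℕ := ∏ ν ∈ S, (ν : ℕ)
  have hP0 : (P : ℤ) ≠ 0 := by
    exact_mod_cast Finset.prod_ne_zero_iff.2 fun (ν : Nat.Primes) _ => ν.2.ne_zero
  obtain ⟨s, hs, hsle⟩ := exists_pos_forall_le_mul_rpow hη_lt hε₀ (P * K)
  refine ⟨s * ε₀, mul_pos hs hε₀, fun T => ?_⟩
  obtain ⟨H, hH, hlarge⟩ := hα (max (max 1 ε₀) (max (T / s) (1 / s)))
  simp only [gt_iff_lt, max_lt_iff, div_lt_iff₀ hs] at hH
  obtain ⟨⟨hH1, hHε⟩, hHT, hHs⟩ := hH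
  have hH0 : 0 < H := one_pos.trans hH1
  obtain ⟨Q, _, f, hf, hQ⟩ := exists_classes_tauNormFin_lt hn hS hτ hτsum hαint
    (mul_pos hε₀ (inv_pos.2 hH0)) (by rw [← div_eq_mul_inv]; exact (div_le_one hH0).2 hHε.le)
  obtain ⟨v, hv, hvL⟩ := hbox (fun ℓ => H ^ η ℓ)
    (fun ℓ => Real.one_le_rpow hH1.le (hη ℓ).le) Q f
    {x | tauNormFin n S τ (linearFormValue α x) < ε₀ * H⁻¹} hf (by
      refine hQ.trans_eq ?_
      rw [← Real.rpow_sum_of_pos hH0, hηsum, mul_inv, inv_inv, mul_pow, ← mul_assoc,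
        ← Real.rpow_natCast H]
      push_cast
      rfl) (fun x hx hxB => by
      by_contra hne
      refine absurd (etaNormPair_le hm hη hH0.le hxB) (not_le.2 (hlarge _ _ ?_ hx))
      intro h1 h2
      exact hne (funext fun ℓ => Fin.addCases (congrFun h1) (congrFun h2) ℓ))
  have hbound : ∀ ℓ k, |(P * v ℓ k : ℝ)| ≤
      ((s * ε₀)⁻¹ ^ (m + n) * ∏ ν ∈ S, ((ν : ℕ) : ℝ) ^ (m + 2 * n)) * (s * H) ^ η k := by
    intro ℓ k
    have h1 : (1 : ℝ) ≤ ∏ ν ∈ S, ((ν : ℕ) : ℝ) ^ (m + 2 * n) :=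
      Finset.prod_const_one.symm.trans_le
        (Finset.prod_le_prod (fun _ _ => zero_le_one) fun ν _ => one_le_pow₀ (hprime ν))
    calc |(P * v ℓ k : ℝ)| = P * |(v ℓ k : ℝ)| := by rw [abs_mul, Nat.abs_cast]
      _ ≤ P * (K * H ^ η k) := by gcongr; exact (hvL ℓ).2 k
      _ = (P * K) * H ^ η k := by ring
      _ ≤ ((s * ε₀)⁻¹ ^ (m + n) * s ^ η k) * H ^ η k :=
          mul_le_mul_of_nonneg_right (hsle k) (by positivity)
      _ = ((s * ε₀)⁻¹ ^ (m + n) * 1) * (s * H) ^ η k := by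
          rw [Real.mul_rpow hs.le hH0.le]; ring
      _ ≤ _ := by gcongr
  have hdiv : ∀ (ν : {ν // ν ∈ S}) (c : ℤ),
      ‖((P * c : ℤ) : ℚ_[(ν : Nat.Primes)])‖ ≤ (((ν : Nat.Primes) : ℕ) : ℝ)⁻¹ := fun ν c => by
    have h := (Padic.norm_int_le_pow_iff_dvd (p := (ν : Nat.Primes)) (P * c : ℤ) 1).2 (by
      rw [pow_one]
      exact Dvd.dvd.mul_right (by exact_mod_cast Finset.dvd_prod_of_mem _ ν.2) c)
    simpa only [Nat.cast_one, zpow_neg_one] using h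
  refine ⟨s * H, by linarith, by linarith, scaleSplit m n P ∘ v,
    hv.map' _ (ker_scaleSplit hP0), fun ℓ => ⟨?_, fun j => ?_, fun i => ?_, fun ν =>
      ⟨fun j => hdiv ν _, fun i => ?_⟩⟩⟩
  · have hε : s * ε₀ * (s * H)⁻¹ = ε₀ * H⁻¹ := by field_simp
    have ht : 0 < ε₀ * H⁻¹ := by positivity
    rw [hε]
    refine (tauNormFin_lt_iff hn hS hτ ht).2 fun ν i =>
      lt_of_le_of_lt ?_ ((tauNormFin_lt_iff hn hS hτ ht).1 (hvL ℓ).1 ν i)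
    have hval : (∑ j, (((scaleSplit m n P ∘ v) ℓ).1 j : ℚ_[(ν : Nat.Primes)]) * α ν i j)
        + (((scaleSplit m n P ∘ v) ℓ).2 i : ℚ_[(ν : Nat.Primes)])
        = ((P : ℤ) : ℚ_[(ν : Nat.Primes)]) * linearFormValue α (v ℓ) ν i := by
      simp only [scaleSplit, linearFormValue, Function.comp_apply, LinearMap.coe_mk,
        AddHom.coe_mk, Int.cast_mul, Int.cast_neg, mul_sub, Finset.mul_sum, mul_assoc]
      ring
    rw [hval, norm_mul]
    exact mul_le_of_le_one_left (norm_nonneg _) (Padic.norm_int_le_one _)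
  · have h := hbound ℓ (Fin.castAdd n j)
    simpa [scaleSplit] using h
  · have h := hbound ℓ (Fin.natAdd m i)
    simpa [scaleSplit] using h
  · have h := hdiv ν (v ℓ (Fin.natAdd m i))
    rw [← norm_neg, ← Int.cast_neg] at h
    exact h
end

section
/- Let α be a real m×n matrix that is (τ,η)-non-singular. Then there exists a constant C_0 > 0 such that for arbitrarily large t > 0 there exist m + n linearly independent vectors (a^{(1)}, b^{(1)}), …, (a^{(m+n)}, b^{(m+n)}) ∈ ℤ^m × ℤ^n satisfying, for each ℓ: |(a^{(ℓ)}α − b^{(ℓ)})_i| ≤ C_0 e^{−τ_i t} for all 1 ≤ i ≤ n, and |a^{(ℓ)}_j| ≤ C_0 e^{η_j t} for all 1 ≤ j ≤ m. -/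
open MeasureTheory Module

/-- **Minkowski's theorem on linear forms**, for the lattice of integer vectors. -/
theorem exists_int_ne_zero_abs_mulVec_lt {ι : Type*} [Fintype ι] [DecidableEq ι]
    (A : Matrix ι ι ℝ) (hA : A.det ≠ 0) (c : ι → ℝ) (hc : ∀ i, 0 < c i)
    (h : |A.det| < ∏ i, c i) :
    ∃ z : ι → ℤ, z ≠ 0 ∧ ∀ i, |A.mulVec (fun k => (z k : ℝ)) i| < c i := by
  set box : Set (ι → ℝ) := Set.univ.pi fun i => Set.Ioo (-c i) (c i) with hbox
  have hvol : volume (Matrix.toLin' A ⁻¹' box) =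
      ENNReal.ofReal (|A.det|⁻¹ * ∏ i, (2 * c i)) := by
    rw [Measure.addHaar_preimage_linearMap _ (by simpa using hA), hbox, Real.volume_pi_Ioo,
      ← ENNReal.ofReal_prod_of_nonneg (fun i _ => by linarith [hc i]),
      ← ENNReal.ofReal_mul (abs_nonneg _), LinearMap.det_toLin', abs_inv]
    congr 2
    exact Finset.prod_congr rfl fun i _ => by ring
  have hfund : volume (ZSpan.fundamentalDomain (Pi.basisFun ℝ ι)) = 1 := by
    simp [ZSpan.fundamentalDomain_pi_basisFun, Real.volume_pi_Ico]
  have hlt : volume (ZSpan.fundamentalDomain (Pi.basisFun ℝ ι)) * 2 ^ finrank ℝ (ι → ℝ) <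
      volume (Matrix.toLin' A ⁻¹' box) := by
    have hpow : (2 : ENNReal) ^ Fintype.card ι = ENNReal.ofReal (2 ^ Fintype.card ι) := by
      rw [ENNReal.ofReal_pow (by norm_num)]; norm_num
    have hdet : 0 < |A.det| := abs_pos.mpr hA
    rw [hfund, hvol, one_mul, Module.finrank_fintype_fun_eq_card, hpow,
      ENNReal.ofReal_lt_ofReal_iff_of_nonneg (by positivity), Finset.prod_mul_distrib,
      Finset.prod_const, Finset.card_univ, inv_mul_eq_div, lt_div_iff₀ hdet]
    gcongr
  have hsymm : ∀ x ∈ Matrix.toLin' A ⁻¹' box, -x ∈ Matrix.toLin' A ⁻¹' box := fun x hx i _ => by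
    have := hx i trivial
    simp only [map_neg, Pi.neg_apply, Set.mem_Ioo] at this ⊢
    constructor <;> linarith
  have hconv : Convex ℝ (Matrix.toLin' A ⁻¹' box) :=
    (convex_pi fun i _ => convex_Ioo _ _).linear_preimage _
  have : Countable (Submodule.span ℤ (Set.range (Pi.basisFun ℝ ι))).toAddSubgroup :=
    inferInstanceAs <| Countable (Submodule.span ℤ (Set.range (Pi.basisFun ℝ ι)))
  obtain ⟨⟨x, hx⟩, hx0, hxs⟩ := exists_ne_zero_mem_lattice_of_measure_mul_two_pow_lt_measure
    (ZSpan.isAddFundamentalDomain' (Pi.basisFun ℝ ι) volume) hsymm hconv hlt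
  choose z hz using ((Pi.basisFun ℝ ι).mem_span_iff_repr_mem ℤ x).mp hx
  have hzx : (fun k => (z k : ℝ)) = x := by
    ext k
    simpa using hz k
  refine ⟨z, ?_, fun i => ?_⟩
  · rintro rfl
    exact hx0 (Subtype.ext (hzx.symm.trans (funext fun _ => Int.cast_zero)))
  · rw [hzx, abs_lt]
    exact hxs i trivial

/-- A unimodular lattice all of whose nonzero vectors have sup norm at least `δ` contains a
linearly independent family of maximal size whose members are bounded in terms of `δ` and the
dimension. -/
theorem exists_linearIndependent_abs_mulVec_le {ι : Type*} [Fintype ι] [DecidableEq ι] {N : ℕ}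
    (hN : Fintype.card ι = N) (M : Matrix ι ι ℝ) (hM : |M.det| = 1) {δ : ℝ} (hδ : 0 < δ)
    (hmin : ∀ z : ι → ℤ, z ≠ 0 → ∃ i, δ ≤ |M.mulVec (fun k => (z k : ℝ)) i|) :
    ∃ v : Fin N → ι → ℤ, LinearIndependent ℝ (fun l => M.mulVec fun k => (v l k : ℝ)) ∧
      ∀ l i, |M.mulVec (fun k => (v l k : ℝ)) i| ≤ 2 * (N / δ) ^ (N - 1) + δ := by
  set R : ℝ := 2 * (N / δ) ^ (N - 1) with hR
  set S : Set (ι → ℝ) := {x | ∃ z : ι → ℤ, M.mulVec (fun k => (z k : ℝ)) = x ∧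
    ∀ i, |x i| ≤ R + δ} with hS
  have hspan : Submodule.span ℝ S = ⊤ := by
    by_contra hne
    obtain ⟨f, hf0, hf⟩ := Submodule.exists_le_ker_of_lt_top _ (lt_top_iff_ne_top.mpr hne)
    have hfx : ∀ x, f x = ∑ i, f (Pi.single i 1) * x i := fun x => by
      conv_lhs => rw [← Finset.univ_sum_single x]
      rw [map_sum]
      refine Finset.sum_congr rfl fun i _ => ?_
      have : (Pi.single i (x i) : ι → ℝ) = x i • Pi.single i 1 := by simp [← Pi.single_smul]
      rw [this, map_smul, smul_eq_mul, mul_comm]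
    have : Nonempty ι := by
      by_contra hempty
      rw [not_nonempty_iff] at hempty
      exact hf0 (LinearMap.ext fun x => by simp [hfx x])
    obtain ⟨i₀, hi₀⟩ := Finite.exists_max fun i => |f (Pi.single i 1)|
    have hpos : f (Pi.single i₀ 1) ≠ 0 := fun h0 => hf0 <| LinearMap.ext fun x => by
      have : ∀ i, f (Pi.single i 1) = 0 := fun i => by
        have := hi₀ i
        rw [h0, abs_zero] at this
        exact abs_nonpos_iff.mp this
      simp [hfx x, this]
    set g : ι → ℝ := fun i => f (Pi.single i 1) / f (Pi.single i₀ 1) with hg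
    have hg1 : g i₀ = 1 := div_self hpos
    have hgle : ∀ i, |g i| ≤ 1 := fun i => by
      rw [hg, abs_div]
      exact div_le_one_of_le₀ (hi₀ i) (abs_nonneg _)
    have hgS : ∀ x ∈ S, g ⬝ᵥ x = 0 := fun x hx => by
      have h0 : f x = 0 := hf (Submodule.subset_span hx)
      rw [hfx] at h0
      simp only [dotProduct, hg, div_mul_eq_mul_div, ← Finset.sum_div, h0, zero_div]
    have hNpos : 0 < N := hN ▸ Fintype.card_pos
    have hNpos' : (0 : ℝ) < N := by exact_mod_cast hNpos
    have hRpos : 0 < R := by positivity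
    set c : ι → ℝ := Function.update (fun _ => δ / N) i₀ R with hc
    have hdet : |((1 : Matrix ι ι ℝ).updateRow i₀ g * M).det| = 1 := by
      rw [Matrix.det_mul, abs_mul, hM, ← Matrix.cramer_transpose_apply, Matrix.transpose_one,
        Matrix.cramer_one]
      simp [hg1]
    obtain ⟨z, hz0, hz⟩ := exists_int_ne_zero_abs_mulVec_lt
      ((1 : Matrix ι ι ℝ).updateRow i₀ g * M) (fun h0 => by simp [h0] at hdet) c
      (fun i => by
        rcases eq_or_ne i i₀ with rfl | hi
        · simpa [hc] using hRpos
        · simp only [hc, Function.update_of_ne hi]; positivity)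
      (by
        rw [hdet, hc, Finset.prod_update_of_mem (Finset.mem_univ _), Finset.prod_const,
          ← Finset.compl_eq_univ_sdiff, Finset.card_compl, Finset.card_singleton, hN, hR, mul_assoc,
          ← mul_pow, div_mul_div_cancel₀ hδ.ne', div_self hNpos'.ne']
        norm_num)
    set x := M.mulVec (fun k => (z k : ℝ)) with hx
    have hz_ne : ∀ i, i ≠ i₀ → |x i| < δ / N := fun i hi => by
      have := hz i
      rwa [← Matrix.mulVec_mulVec, Matrix.mulVec, Matrix.updateRow_ne hi, hc,
        Function.update_of_ne hi, ← Matrix.mulVec, Matrix.one_mulVec] at this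
    have hz_eq : |g ⬝ᵥ x| < R := by
      have := hz i₀
      rwa [← Matrix.mulVec_mulVec, Matrix.mulVec, Matrix.updateRow_self, hc,
        Function.update_self] at this
    have hx₀ : |x i₀| < |g ⬝ᵥ x| + δ := by
      have hsplit : g ⬝ᵥ x = x i₀ + ∑ i ∈ Finset.univ.erase i₀, g i * x i := by
        rw [dotProduct, ← Finset.add_sum_erase _ _ (Finset.mem_univ i₀), hg1, one_mul]
      have hsum : |∑ i ∈ Finset.univ.erase i₀, g i * x i| ≤ (N - 1) * (δ / N) := by
        refine (Finset.abs_sum_le_sum_abs _ _).trans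
          ((Finset.sum_le_card_nsmul _ _ (δ / N) fun i hi => ?_).trans_eq ?_)
        · rw [abs_mul]
          exact (mul_le_of_le_one_left (abs_nonneg _) (hgle i)).trans
            (hz_ne i (Finset.ne_of_mem_erase hi)).le
        · rw [Finset.card_erase_of_mem (Finset.mem_univ _), Finset.card_univ, hN, nsmul_eq_mul,
            Nat.cast_pred hNpos]
      have hlt : (N - 1) * (δ / N) < δ := by
        have hNδ : N * (δ / N) = δ := mul_div_cancel₀ _ hNpos'.ne'
        have : 0 < δ / N := by positivity
        linarith
      have : x i₀ = g ⬝ᵥ x - ∑ i ∈ Finset.univ.erase i₀, g i * x i := by rw [hsplit]; ring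
      rw [this]
      exact (abs_sub _ _).trans_lt (by linarith)
    have hle : δ / N ≤ δ := div_le_self hδ.le (by exact_mod_cast hNpos)
    have hxS : x ∈ S := ⟨z, rfl, fun i => by
      rcases eq_or_ne i i₀ with rfl | hi
      · linarith
      · linarith [hz_ne i hi]⟩
    obtain ⟨i, hi⟩ := hmin z hz0
    rcases eq_or_ne i i₀ with rfl | hne'
    · rw [hgS x hxS, abs_zero] at hx₀
      linarith
    · linarith [hz_ne i hne']
  have hfin : finrank ℝ (Submodule.span ℝ S) = N := by
    rw [hspan, finrank_top, Module.finrank_fintype_fun_eq_card, hN]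
  obtain ⟨w, hwS, -, hw⟩ := Submodule.exists_fun_fin_finrank_span_eq ℝ S
  choose v hv hvle using hwS
  refine ⟨fun l => v (l.cast hfin.symm), ?_, fun l i => ?_⟩
  · simp only [hv]
    exact hw.comp _ (Fin.cast_injective _)
  · rw [hv]
    exact hvle _ i

/-- The matrix sending `(a, b)` to the vector with coordinates `e^{-η_j t} a_j` and
`e^{τ_i t} (a α - b)_i`. -/
noncomputable def flowMatrix {m n : ℕ} (τ : Fin n → ℝ) (η : Fin m → ℝ)
    (α : Matrix (Fin m) (Fin n) ℝ) (t : ℝ) : Matrix (Fin m ⊕ Fin n) (Fin m ⊕ Fin n) ℝ :=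
  Matrix.diagonal (Sum.elim (fun j => Real.exp (-(η j) * t)) fun i => Real.exp (τ i * t)) *
    Matrix.fromBlocks 1 0 α.transpose (-1)

section flowMatrix

variable {m n : ℕ} (τ : Fin n → ℝ) (η : Fin m → ℝ) (α : Matrix (Fin m) (Fin n) ℝ) (t : ℝ)

theorem flowMatrix_mulVec_inl (x : Fin m ⊕ Fin n → ℝ) (j : Fin m) :
    (flowMatrix τ η α t).mulVec x (Sum.inl j) = Real.exp (-(η j) * t) * x (Sum.inl j) := by
  simp [flowMatrix, ← Matrix.mulVec_mulVec, Matrix.mulVec_diagonal, Matrix.fromBlocks_mulVec]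

theorem flowMatrix_mulVec_inr (x : Fin m ⊕ Fin n → ℝ) (i : Fin n) :
    (flowMatrix τ η α t).mulVec x (Sum.inr i) =
      Real.exp (τ i * t) * (∑ j, x (Sum.inl j) * α j i - x (Sum.inr i)) := by
  simp [flowMatrix, ← Matrix.mulVec_mulVec, Matrix.mulVec_diagonal, Matrix.fromBlocks_mulVec,
    Matrix.mulVec_transpose, Matrix.vecMul, dotProduct, Matrix.neg_mulVec, sub_eq_add_neg]

theorem abs_det_flowMatrix (hw : ∑ i, τ i = ∑ j, η j) : |(flowMatrix τ η α t).det| = 1 := by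
  have h : (∏ j, Real.exp (-(η j) * t)) * ∏ i, Real.exp (τ i * t) = 1 := by
    rw [← Real.exp_sum, ← Real.exp_sum, ← Finset.sum_mul, ← Finset.sum_mul, ← Real.exp_add, hw,
      Finset.sum_neg_distrib]
    simp
  rw [flowMatrix, Matrix.det_mul, Matrix.det_fromBlocks_zero₁₂, Matrix.det_diagonal,
    Fintype.prod_sum_type]
  simp only [Sum.elim_inl, Sum.elim_inr, h]
  simp [Matrix.det_neg]

end flowMatrix

theorem quasiNorm_lt_of_forall {n : ℕ} (hn : 0 < n) {τ x : Fin n → ℝ} (hτ : ∀ i, 0 < τ i) {r : ℝ}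
    (hr : 0 ≤ r) (h : ∀ i, |x i| < r ^ τ i) : quasiNorm τ x < r := by
  have : Nonempty (Fin n) := ⟨⟨0, hn⟩⟩
  obtain ⟨i, hi⟩ := exists_eq_ciSup_of_finite (f := fun i => |x i| ^ (1 / τ i))
  rw [quasiNorm, ← hi, one_div, Real.rpow_inv_lt_iff_of_pos (abs_nonneg _) hr (hτ i)]
  exact h i

theorem quasiNorm_le_of_forall {n : ℕ} (hn : 0 < n) {τ x : Fin n → ℝ} (hτ : ∀ i, 0 < τ i) {r : ℝ}
    (hr : 0 ≤ r) (h : ∀ i, |x i| ≤ r ^ τ i) : quasiNorm τ x ≤ r := by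
  have : Nonempty (Fin n) := ⟨⟨0, hn⟩⟩
  refine ciSup_le fun i => ?_
  rw [one_div, Real.rpow_inv_le_iff_of_pos (abs_nonneg _) hr (hτ i)]
  exact h i

/-- For a `(τ,η)`-non-singular real matrix `α`, there is a constant `C₀ > 0` such
that for arbitrarily large `t > 0` there are `m+n` linearly independent integer
vectors `(a^{(ℓ)}, b^{(ℓ)})` with `|(a^{(ℓ)}α - b^{(ℓ)})_i| ≤ C₀ e^{-τ_i t}` and
`|a^{(ℓ)}_j| ≤ C₀ e^{η_j t}`. -/
theorem nonsingular_linearly_independent_vectors_real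
    (m n : ℕ) (hm : 0 < m) (hn : 0 < n)
    (τ : Fin n → ℝ) (η : Fin m → ℝ)
    (hτ : ∀ i, 0 < τ i) (hη : ∀ j, 0 < η j)
    (hw : ∑ i, τ i = ∑ j, η j)
    (α : Matrix (Fin m) (Fin n) ℝ) (hα : ¬ IsSingular τ η α) :
    ∃ C₀ : ℝ, 0 < C₀ ∧ ∀ T : ℝ, ∃ t : ℝ, 0 < t ∧ T < t ∧
      ∃ v : Fin (m + n) → (Fin m → ℤ) × (Fin n → ℤ),
        LinearIndependent ℤ v ∧
        ∀ ℓ,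
          (∀ i : Fin n, |(∑ j, ((v ℓ).1 j : ℝ) * α j i) - ((v ℓ).2 i : ℝ)|
            ≤ C₀ * Real.exp (-(τ i) * t)) ∧
          (∀ j : Fin m, |((v ℓ).1 j : ℝ)| ≤ C₀ * Real.exp (η j * t)) := by
  rw [IsSingular] at hα
  push Not at hα
  obtain ⟨ε, hε, hα⟩ := hα
  have : Nonempty (Fin n) := ⟨⟨0, hn⟩⟩
  obtain ⟨i₁, hi₁⟩ := Finite.exists_min fun i => ε ^ τ i
  set δ : ℝ := min 1 (ε ^ τ i₁) with hδ
  have hδ0 : 0 < δ := lt_min one_pos (Real.rpow_pos_of_pos hε _)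
  refine ⟨2 * ((m + n : ℕ) / δ) ^ (m + n - 1) + δ, by positivity, fun T => ?_⟩
  obtain ⟨H, hH, hns⟩ := hα (max (Real.exp T) (max 1 ε))
  simp only [max_lt_iff] at hH
  obtain ⟨hHT, hH1, hHε⟩ := hH
  have hH0 : 0 < H := one_pos.trans hH1
  set t := Real.log H with ht
  have hexp : ∀ s, Real.exp (s * t) = H ^ s := fun s => by
    rw [Real.rpow_def_of_pos hH0, mul_comm]
  have hmin : ∀ z : Fin m ⊕ Fin n → ℤ, z ≠ 0 →
      ∃ k, δ ≤ |(flowMatrix τ η α t).mulVec (fun k => (z k : ℝ)) k| := by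
    intro z hz
    by_contra! hlt
    have hinl : ∀ j, |(z (Sum.inl j) : ℝ)| < H ^ η j := fun j => by
      have := (hlt (Sum.inl j)).trans_le (min_le_left _ _)
      rwa [flowMatrix_mulVec_inl, abs_mul, Real.abs_exp, neg_mul, Real.exp_neg, hexp,
        inv_mul_lt_iff₀ (Real.rpow_pos_of_pos hH0 _), mul_one] at this
    have hinr : ∀ i, |∑ j, (z (Sum.inl j) : ℝ) * α j i - z (Sum.inr i)| < (ε * H⁻¹) ^ τ i :=
      fun i => by
      have := (hlt (Sum.inr i)).trans_le ((min_le_right _ _).trans (hi₁ i))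
      rwa [flowMatrix_mulVec_inr, abs_mul, Real.abs_exp, hexp, mul_comm,
        ← lt_div_iff₀ (Real.rpow_pos_of_pos hH0 _), ← Real.div_rpow hε.le hH0.le,
        div_eq_mul_inv] at this
    have hr : 0 < ε * H⁻¹ := by positivity
    by_cases ha : (fun j => z (Sum.inl j)) = 0
    · refine hz (funext (Sum.rec (fun j => congrFun ha j) fun i => ?_))
      have hlt1 : (ε * H⁻¹) ^ τ i < 1 := Real.rpow_lt_one hr.le
        (by rwa [← div_eq_mul_inv, div_lt_one hH0]) (hτ i)
      have hb := (hinr i).trans hlt1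
      have ha' : ∀ j, z (Sum.inl j) = 0 := congrFun ha
      simp only [ha', Int.cast_zero, zero_mul, Finset.sum_const_zero, zero_sub, abs_neg] at hb
      exact Int.abs_lt_one_iff.mp (by exact_mod_cast hb)
    · exact absurd (quasiNorm_le_of_forall hm hη hH0.le fun j => (hinl j).le) (not_le.mpr
        (hns (fun j => z (Sum.inl j)) (fun i => z (Sum.inr i)) ha
          (quasiNorm_lt_of_forall hn hτ hr.le hinr)))
  obtain ⟨v, hv, hvle⟩ := exists_linearIndependent_abs_mulVec_le (N := m + n) (by simp)
    (flowMatrix τ η α t) (abs_det_flowMatrix τ η α t hw) hδ0 hmin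
  refine ⟨t, Real.log_pos hH1, (Real.lt_log_iff_exp_lt hH0).mpr hHT,
    fun l => (fun j => v l (Sum.inl j), fun i => v l (Sum.inr i)), ?_, fun l => ⟨fun i => ?_,
      fun j => ?_⟩⟩
  · let φ : (Fin m → ℤ) × (Fin n → ℤ) →ₗ[ℤ] (Fin m ⊕ Fin n → ℝ) :=
      ((Matrix.toLin' (flowMatrix τ η α t)).restrictScalars ℤ).comp
        ((((Int.castAddHom ℝ).toIntLinearMap.compLeft _)).comp
          (LinearEquiv.sumArrowLequivProdArrow (Fin m) (Fin n) ℤ ℤ).symm.toLinearMap)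
    refine LinearIndependent.of_comp φ ?_
    convert hv.restrict_scalars' ℤ using 2 with l
    simp only [φ, Function.comp_apply, LinearMap.comp_apply, LinearMap.restrictScalars_apply,
      Matrix.toLin'_apply]
    congr 1
    ext (j | i) <;> simp
  · have := hvle l (Sum.inr i)
    rw [flowMatrix_mulVec_inr, abs_mul, Real.abs_exp] at this
    rwa [neg_mul, Real.exp_neg, ← div_eq_mul_inv, le_div_iff₀ (Real.exp_pos _), mul_comm]
  · have := hvle l (Sum.inl j)
    rwa [flowMatrix_mulVec_inl, abs_mul, Real.abs_exp, neg_mul, Real.exp_neg,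
      inv_mul_le_iff₀ (Real.exp_pos _), mul_comm] at this
end
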